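/- Under the hypotheses of the annealed CLT for an admissible iterated function system, for every x ∈ (0,1) and t ∈ ℝ, |Φ_n^x(t) − Φ_n(t)| → 0 as n → ∞, where Φ_n and Φ_n^x are the characteristic functions of (φ(X₀)+⋯+φ(X_n))/√n for the chain started from μ* and from δ_x respectively. Consequently (φ(X₀^x)+⋯+φ(X_n^x))/√n ⇒ N(0,σ²) for every x ∈ (0,1). -/

import Mathlib

open Set MeasureTheory Finset Filter

/-- An admissible iterated function system on `[0,1]`: increasing homeomorphisms of
`[0,1]` fixing the endpoints, `C¹` near the endpoints with positive derivatives
`d i` at `0` and `e i` at `1`, positive probabilities, positive Lyapunov exponents at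
both endpoints, and at every interior point some map moves it left and some right. -/
structure AdmissibleIFS (N : ℕ) (f : Fin N → ℝ → ℝ) (p d e : Fin N → ℝ) : Prop where
  meas : ∀ i, Measurable (f i)
  mono : ∀ i, StrictMonoOn (f i) (Icc 0 1)
  maps : ∀ i, MapsTo (f i) (Icc 0 1) (Icc 0 1)
  cont : ∀ i, ContinuousOn (f i) (Icc 0 1)
  surj : ∀ i, SurjOn (f i) (Icc 0 1) (Icc 0 1)
  fix0 : ∀ i, f i 0 = 0
  fix1 : ∀ i, f i 1 = 1
  ppos : ∀ i, 0 < p i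
  psum : ∑ i, p i = 1
  c1 : ∀ i, ∃ η > (0:ℝ), ContDiffOn ℝ 1 (f i) (Icc 0 η) ∧ ContDiffOn ℝ 1 (f i) (Icc (1 - η) 1)
  deriv0 : ∀ i, HasDerivWithinAt (f i) (d i) (Icc 0 1) 0
  deriv1 : ∀ i, HasDerivWithinAt (f i) (e i) (Icc 0 1) 1
  dpos : ∀ i, 0 < d i
  epos : ∀ i, 0 < e i
  lyap0 : 0 < ∑ i, p i * Real.log (d i)
  lyap1 : 0 < ∑ i, p i * Real.log (e i)
  interior : ∀ x ∈ Ioo (0:ℝ) 1, (∃ i, f i x < x) ∧ (∃ j, x < f j x)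

/-- Iterates along a sequence of indices: `wordIter f ω n = f_{ω (n-1)} ∘ ⋯ ∘ f_{ω 0}`. -/
def wordIter {N : ℕ} (f : Fin N → ℝ → ℝ) (ω : ℕ → Fin N) : ℕ → ℝ → ℝ
  | 0 => id
  | n + 1 => f (ω n) ∘ wordIter f ω n

/-- `⌊n^{1/4}⌋`. -/
noncomputable def nroot4 (n : ℕ) : ℕ := ⌊(n : ℝ) ^ ((1 : ℝ) / 4)⌋₊

/-- Application of a finite word: `applyWord f [i₁, …, iₙ] x = f_{iₙ}(⋯ f_{i₁}(x) ⋯)`. -/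
def applyWord {N : ℕ} (f : Fin N → ℝ → ℝ) (w : List (Fin N)) (x : ℝ) : ℝ :=
  w.foldl (fun y a => f a y) x

/-- The characteristic function of `(φ(X₁^x)+⋯+φ(X_n^x))/√n` for the chain started
at `x`:
`Φₙˣ(t) = ∑_{(i₁,…,iₙ)} p_{i₁}⋯p_{iₙ} exp(i t (φ(f_i^1 x)+⋯+φ(f_i^n x))/√n)`. -/
noncomputable def charFn {N : ℕ} (f : Fin N → ℝ → ℝ) (p : Fin N → ℝ) (φ : ℝ → ℝ)
    (n : ℕ) (t x : ℝ) : ℂ :=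
  ∑ w : Fin n → Fin N, ((∏ k, p (w k) : ℝ) : ℂ) *
    Complex.exp (Complex.I * (t : ℂ) *
      (((∑ j ∈ Finset.Icc 1 n, φ (applyWord f ((List.ofFn w).take j) x)) / Real.sqrt n : ℝ) : ℂ))

/-- Markov operator. -/
noncomputable def mkOp {ι : Type} [Fintype ι] (q : ι → ℝ) (F : ι → ℝ → ℝ) (g : ℝ → ℝ) (x : ℝ) : ℝ :=
  ∑ i, q i * g (F i x)

/-- Monotone functions with values in the unit interval. -/
def GoodFn (g : ℝ → ℝ) : Prop :=
  MonotoneOn g (Set.Ioo 0 1) ∧ ∀ x ∈ Set.Ioo (0:ℝ) 1, 0 ≤ g x ∧ g x ≤ 1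

lemma goodFn_mkOp {ι : Type} [Fintype ι] (q : ι → ℝ) (F : ι → ℝ → ℝ)
    (hq : ∀ i, 0 ≤ q i) (hs : ∑ i, q i = 1)
    (hF : ∀ i, ∀ x ∈ Set.Ioo (0:ℝ) 1, F i x ∈ Set.Ioo (0:ℝ) 1)
    (hm : ∀ i, MonotoneOn (F i) (Set.Ioo 0 1)) (g : ℝ → ℝ) (hg : GoodFn g) :
    GoodFn (mkOp q F g) := by
  refine ⟨fun x hx y hy hxy => ?_, fun x hx => ⟨?_, ?_⟩⟩
  · exact Finset.sum_le_sum fun i _ => mul_le_mul_of_nonneg_left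
      (hg.1 (hF i x hx) (hF i y hy) (hm i hx hy hxy)) (hq i)
  · exact Finset.sum_nonneg fun i _ => mul_nonneg (hq i) (hg.2 _ (hF i x hx)).1
  · calc mkOp q F g x ≤ ∑ i, q i * 1 := Finset.sum_le_sum fun i _ =>
          mul_le_mul_of_nonneg_left (hg.2 _ (hF i x hx)).2 (hq i)
      _ = 1 := by simp [hs]

lemma goodFn_iter {ι : Type} [Fintype ι] (q : ι → ℝ) (F : ι → ℝ → ℝ)
    (hq : ∀ i, 0 ≤ q i) (hs : ∑ i, q i = 1)
    (hF : ∀ i, ∀ x ∈ Set.Ioo (0:ℝ) 1, F i x ∈ Set.Ioo (0:ℝ) 1)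
    (hm : ∀ i, MonotoneOn (F i) (Set.Ioo 0 1)) (g : ℝ → ℝ) (hg : GoodFn g) (n : ℕ) :
    GoodFn ((mkOp q F)^[n] g) := by
  induction n with
  | zero => simpa using hg
  | succ n ih => rw [Function.iterate_succ_apply']; exact goodFn_mkOp q F hq hs hF hm _ ih

lemma mkOp_sum {ι : Type} [Fintype ι] (q : ι → ℝ) (F : ι → ℝ → ℝ) (G : ℕ → ℝ → ℝ) (s : Finset ℕ)
    (x : ℝ) : mkOp q F (fun y => ∑ k ∈ s, G k y) x = ∑ k ∈ s, mkOp q F (G k) x := by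
  simp only [mkOp, Finset.mul_sum]
  rw [Finset.sum_comm]

lemma core {ι : Type} [Fintype ι] [DecidableEq ι] (q : ι → ℝ) (F : ι → ℝ → ℝ)
    (hq : ∀ i, 0 ≤ q i) (hs : ∑ i, q i = 1)
    (hF : ∀ i, ∀ x ∈ Set.Ioo (0:ℝ) 1, F i x ∈ Set.Ioo (0:ℝ) 1)
    (hm : ∀ i, MonotoneOn (F i) (Set.Ioo 0 1))
    (V : ℝ → ℝ) (hV : ∀ x ∈ Set.Ioo (0:ℝ) 1, 0 ≤ V x) (lam C R B : ℝ)
    (hlam : lam < 1) (hC : 0 ≤ C) (hB : 0 ≤ B)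
    (drift : ∀ x ∈ Set.Ioo (0:ℝ) 1, mkOp q F V x ≤ lam * V x + C)
    (a b : ι) (cross : ∀ u ∈ Set.Ioo (0:ℝ) 1, ∀ v ∈ Set.Ioo (0:ℝ) 1, V u ≤ R → V v ≤ R →
      F a v ≤ F b u)
    (hR : 2 * C + 1 ≤ (1 - lam) * R) (hBδ : 2 * C + 1 ≤ B * (q b * q a))
    (g : ℝ → ℝ) (hg : GoodFn g) (K : ℕ) :
    ∀ u ∈ Set.Ioo (0:ℝ) 1, ∀ v ∈ Set.Ioo (0:ℝ) 1, u < v →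
      ∑ k ∈ Finset.range K, ((mkOp q F)^[k] g v - (mkOp q F)^[k] g u) ≤ V u + V v + B := by
  induction K with
  | zero =>
    intro u hu v hv _
    have := hV u hu
    have := hV v hv
    simp; linarith
  | succ K ih =>
    intro u hu v hv huv
    set G : ℝ → ℝ := fun y => ∑ k ∈ Finset.range K, (mkOp q F)^[k] g y with hG
    have hGm : MonotoneOn G (Set.Ioo 0 1) := fun x hx y hy hxy =>
      Finset.sum_le_sum fun k _ => (goodFn_iter q F hq hs hF hm g hg k).1 hx hy hxy
    have ih' : ∀ u ∈ Set.Ioo (0:ℝ) 1, ∀ v ∈ Set.Ioo (0:ℝ) 1, G v - G u ≤ V u + V v + B := by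
      intro u hu v hv
      rcases lt_or_ge u v with h | h
      · have := ih u hu v hv h
        rw [Finset.sum_sub_distrib] at this
        exact this
      · have := hGm hv hu h
        have := hV u hu
        have := hV v hv
        linarith
    have hstep : ∑ k ∈ Finset.range (K+1), ((mkOp q F)^[k] g v - (mkOp q F)^[k] g u)
        = (g v - g u) + (mkOp q F G v - mkOp q F G u) := by
      rw [Finset.sum_range_succ', hG, mkOp_sum, mkOp_sum, ← Finset.sum_sub_distrib]
      simp only [Function.iterate_succ_apply', Function.iterate_zero, id]
      ring
    have hpair : ∀ H : ℝ → ℝ, ∀ y, mkOp q F H y = ∑ i, ∑ j, q i * q j * H (F j y) := by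
      intro H y
      simp_rw [mul_assoc, ← Finset.mul_sum]
      rw [← Finset.sum_mul, hs, one_mul]; rfl
    have hpair2 : ∀ H : ℝ → ℝ, ∀ y, mkOp q F H y = ∑ i, ∑ j, q i * q j * H (F i y) := by
      intro H y
      rw [hpair, Finset.sum_comm]
      simp_rw [mul_comm]
    have hone : ∑ i, ∑ j, q i * q j = 1 := by
      simp_rw [← Finset.mul_sum, hs, mul_one, hs]
    have hg1 := hg.2 u hu
    have hg2 := hg.2 v hv
    have hVu := hV u hu
    have hVv := hV v hv
    have du := drift u hu
    have dv := drift v hv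
    rw [hstep, hpair G v, hpair2 G u, ← Finset.sum_sub_distrib]
    simp_rw [← Finset.sum_sub_distrib, ← mul_sub]
    by_cases hin : V u ≤ R ∧ V v ≤ R
    · have key : ∑ i, ∑ j, q i * q j * (G (F j v) - G (F i u)) ≤
          ∑ i, ∑ j, (q i * q j * V (F i u) + q i * q j * V (F j v) + q i * q j * B
            - if i = b then (if j = a then q b * q a * B else 0) else 0) := by
        refine Finset.sum_le_sum fun i _ => Finset.sum_le_sum fun j _ => ?_
        have hqq := mul_nonneg (hq i) (hq j)
        by_cases h : i = b ∧ j = a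
        · obtain ⟨rfl, rfl⟩ := h
          have h1 := hGm (hF _ v hv) (hF _ u hu) (cross u hu v hv hin.1 hin.2)
          have h2 := hV _ (hF j v hv)
          have h3 := hV _ (hF i u hu)
          simp only [if_true]
          have := mul_nonneg hqq (by linarith : 0 ≤ V (F i u) + V (F j v) - (G (F j v) - G (F i u)))
          linarith
        · have h0 : (if i = b then (if j = a then q b * q a * B else 0) else 0) = 0 := by
            split_ifs with h1 h2 <;> simp_all
          rw [h0]
          have := mul_le_mul_of_nonneg_left (ih' _ (hF i u hu) _ (hF j v hv)) hqq
          linarith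
      simp only [Finset.sum_sub_distrib, Finset.sum_add_distrib] at key
      rw [← hpair V v, ← hpair2 V u] at key
      simp only [← Finset.sum_mul, hone] at key
      simp at key
      have h1 := mul_nonneg (by linarith : 0 ≤ 1 - lam) hVu
      have h2 := mul_nonneg (by linarith : 0 ≤ 1 - lam) hVv
      linarith
    · have key : ∑ i, ∑ j, q i * q j * (G (F j v) - G (F i u)) ≤
          ∑ i, ∑ j, (q i * q j * V (F i u) + q i * q j * V (F j v) + q i * q j * B) := by
        refine Finset.sum_le_sum fun i _ => Finset.sum_le_sum fun j _ => ?_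
        have hqq := mul_nonneg (hq i) (hq j)
        have := mul_le_mul_of_nonneg_left (ih' _ (hF i u hu) _ (hF j v hv)) hqq
        linarith
      simp only [Finset.sum_add_distrib] at key
      rw [← hpair V v, ← hpair2 V u] at key
      simp only [← Finset.sum_mul, hone] at key
      have hRV : R ≤ V u + V v := by
        by_contra hc
        exact hin ⟨by linarith, by linarith⟩
      have := mul_le_mul_of_nonneg_left hRV (by linarith : 0 ≤ 1 - lam)
      linarith

lemma drift_end {N : ℕ} (f : Fin N → ℝ → ℝ) (p d : Fin N → ℝ)
    (hp : ∀ i, 0 < p i) (hs : ∑ i, p i = 1) (hd : ∀ i, 0 < d i)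
    (hf0 : ∀ i, f i 0 = 0)
    (hF : ∀ i, ∀ x ∈ Set.Ioo (0:ℝ) 1, f i x ∈ Set.Ioo (0:ℝ) 1)
    (hm : ∀ i, MonotoneOn (f i) (Set.Ioo 0 1))
    (hder : ∀ i, HasDerivWithinAt (f i) (d i) (Set.Icc 0 1) 0)
    (hly : 0 < ∑ i, p i * Real.log (d i)) :
    ∃ (V : ℝ → ℝ) (lam C : ℝ), 0 ≤ lam ∧ lam < 1 ∧ 0 ≤ C ∧ (∀ x ∈ Set.Ioo (0:ℝ) 1, 0 ≤ V x) ∧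
      (∀ x ∈ Set.Ioo (0:ℝ) 1, mkOp p f V x ≤ lam * V x + C) ∧
      ∀ R : ℝ, ∃ ε > 0, ∀ x ∈ Set.Ioo (0:ℝ) 1, V x ≤ R → ε ≤ x := by
  set Λ := ∑ i, p i * Real.log (d i) with hΛ
  obtain ⟨c, hc0, hc1, hcl⟩ : ∃ c : ℝ, 0 < c ∧ c < 1 ∧ Real.log c = -Λ/2 :=
    ⟨Real.exp (-Λ/2), Real.exp_pos _, by rw [Real.exp_lt_one_iff]; linarith, Real.log_exp _⟩
  have hlog : ∑ i, p i * Real.log (c * d i) = Λ / 2 := by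
    have : ∀ i, p i * Real.log (c * d i) = p i * Real.log c + p i * Real.log (d i) := by
      intro i; rw [Real.log_mul hc0.ne' (hd i).ne']; ring
    simp_rw [this, Finset.sum_add_distrib, ← Finset.sum_mul, hs, hcl]
    linarith
  -- choose exponent
  obtain ⟨α, hα, hψ⟩ : ∃ α : ℝ, 0 < α ∧ ∑ i, p i * (c * d i) ^ (-α) < 1 := by
    set ψ : ℝ → ℝ := fun α => ∑ i, p i * Real.exp (Real.log (c * d i) * (-α)) with hψd
    have hder : HasDerivAt ψ (∑ i, p i * (-Real.log (c * d i))) 0 := by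
      apply HasDerivAt.fun_sum
      intro i _
      have h1 : HasDerivAt (fun α : ℝ => Real.log (c * d i) * (-α)) (Real.log (c * d i) * (-1)) 0 :=
        (hasDerivAt_id 0).neg.const_mul _
      have h2 := h1.exp.const_mul (p i)
      simpa using h2
    have hneg : ∑ i, p i * (-Real.log (c * d i)) < 0 := by
      simp only [mul_neg, Finset.sum_neg_distrib, hlog]; linarith
    have ht := hasDerivAt_iff_tendsto_slope.1 hder
    have hev := ht.eventually (gt_mem_nhds hneg)
    have hev2 : ∀ᶠ y in nhdsWithin (0:ℝ) (Set.Ioi 0), slope ψ 0 y < 0 :=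
      hev.filter_mono (nhdsWithin_mono _ (fun y hy => ne_of_gt hy))
    obtain ⟨α, h1, h2⟩ := (hev2.and self_mem_nhdsWithin).exists
    refine ⟨α, h2, ?_⟩
    have hα : 0 < α := h2
    have h0 : ψ 0 = 1 := by simp [hψd, hs]
    rw [slope_def_field, h0, sub_zero, div_neg_iff] at h1
    have h3 : ψ α < 1 := by
      rcases h1 with h | h
      · linarith [h.2]
      · linarith [h.1]
    refine lt_of_eq_of_lt (Finset.sum_congr rfl fun i _ => ?_) h3
    rw [Real.rpow_def_of_pos (mul_pos hc0 (hd i))]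
  -- linear lower bound near 0
  have hlow : ∀ᶠ x in nhdsWithin (0:ℝ) (Set.Ioi 0), ∀ i, c * d i * x ≤ f i x := by
    rw [eventually_all]
    intro i
    have ht := hasDerivWithinAt_iff_tendsto_slope.1 (hder i)
    have hlt : c * d i < d i := by nlinarith [hd i]
    have hev := ht.eventually (lt_mem_nhds hlt)
    have hmono : nhdsWithin (0:ℝ) (Set.Ioi 0) ≤ nhdsWithin 0 (Set.Icc 0 1 \ {0}) := by
      rw [← nhdsWithin_Ioo_eq_nhdsGT (zero_lt_one' ℝ)]
      exact nhdsWithin_mono _ fun y hy => ⟨⟨hy.1.le, hy.2.le⟩, ne_of_gt hy.1⟩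
    filter_upwards [hev.filter_mono hmono, self_mem_nhdsWithin] with x hx hx0
    have hx0 : 0 < x := hx0
    rw [slope_def_field, hf0, sub_zero, sub_zero, lt_div_iff₀ hx0] at hx
    exact hx.le
  obtain ⟨η, hη, hlow⟩ := (mem_nhdsGT_iff_exists_Ioo_subset).1 hlow
  have hη : 0 < η := hη
  set ξ := min (η/2) (1/2) with hξ
  have hξ0 : 0 < ξ := by positivity
  have hξη : ξ < η := lt_of_le_of_lt (min_le_left _ _) (by linarith)
  have hξI : ξ ∈ Set.Ioo (0:ℝ) 1 := ⟨hξ0, lt_of_le_of_lt (min_le_right _ _) (by norm_num)⟩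
  refine ⟨fun x => x ^ (-α), ∑ i, p i * (c * d i) ^ (-α), ∑ i, p i * (f i ξ) ^ (-α), ?_, hψ, ?_, ?_,
    ?_, ?_⟩
  · exact Finset.sum_nonneg fun i _ => mul_nonneg (hp i).le
      (Real.rpow_nonneg (mul_pos hc0 (hd i)).le _)
  · exact Finset.sum_nonneg fun i _ => mul_nonneg (hp i).le
      (Real.rpow_nonneg (hF i ξ hξI).1.le _)
  · exact fun x hx => Real.rpow_nonneg hx.1.le _
  · intro x hx
    rw [Finset.sum_mul, ← Finset.sum_add_distrib]
    refine Finset.sum_le_sum fun i _ => ?_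
    have hA : 0 ≤ (c * d i) ^ (-α) * x ^ (-α) :=
      mul_nonneg (Real.rpow_nonneg (mul_pos hc0 (hd i)).le _) (Real.rpow_nonneg hx.1.le _)
    have hB : 0 ≤ (f i ξ) ^ (-α) := Real.rpow_nonneg (hF i ξ hξI).1.le _
    rw [mul_assoc, ← mul_add]
    refine mul_le_mul_of_nonneg_left ?_ (hp i).le
    rcases lt_or_ge x ξ with h | h
    · have h1 : c * d i * x ≤ f i x := hlow ⟨hx.1, h.trans hξη⟩ i
      have h2 : (f i x) ^ (-α) ≤ (c * d i * x) ^ (-α) :=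
        Real.rpow_le_rpow_of_nonpos (mul_pos (mul_pos hc0 (hd i)) hx.1) h1 (by linarith)
      rw [Real.mul_rpow (mul_pos hc0 (hd i)).le hx.1.le] at h2
      linarith
    · have h2 : (f i x) ^ (-α) ≤ (f i ξ) ^ (-α) :=
        Real.rpow_le_rpow_of_nonpos (hF i ξ hξI).1 (hm i hξI hx h) (by linarith)
      linarith
  · intro R
    refine ⟨(max R 1) ^ (-(1/α)), Real.rpow_pos_of_pos (by positivity) _, fun x hx hxR => ?_⟩
    have h1 : x ^ (-α) ≤ max R 1 := hxR.trans (le_max_left _ _)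
    have h2 := Real.rpow_le_rpow_of_nonpos (Real.rpow_pos_of_pos hx.1 _) h1
      (by have : 0 < 1/α := by positivity
          linarith : -(1/α) ≤ 0)
    rw [← Real.rpow_mul hx.1.le] at h2
    have h3 : -α * -(1/α) = 1 := by field_simp
    rwa [h3, Real.rpow_one] at h2

lemma applyWord_append {N : ℕ} (f : Fin N → ℝ → ℝ) (w w' : List (Fin N)) (x : ℝ) :
    applyWord f (w ++ w') x = applyWord f w' (applyWord f w x) := by
  simp [applyWord]

lemma applyWord_cons {N : ℕ} (f : Fin N → ℝ → ℝ) (i : Fin N) (w : List (Fin N)) (x : ℝ) :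
    applyWord f (i :: w) x = applyWord f w (f i x) := by
  simp [applyWord]

lemma applyWord_mem {N : ℕ} (f : Fin N → ℝ → ℝ)
    (hF : ∀ i, ∀ x ∈ Set.Ioo (0:ℝ) 1, f i x ∈ Set.Ioo (0:ℝ) 1) (w : List (Fin N)) :
    ∀ x ∈ Set.Ioo (0:ℝ) 1, applyWord f w x ∈ Set.Ioo (0:ℝ) 1 := by
  induction w with
  | nil => intro x hx; exact hx
  | cons i w ih => intro x hx; rw [applyWord_cons]; exact ih _ (hF i x hx)

lemma applyWord_mono {N : ℕ} (f : Fin N → ℝ → ℝ)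
    (hF : ∀ i, ∀ x ∈ Set.Ioo (0:ℝ) 1, f i x ∈ Set.Ioo (0:ℝ) 1)
    (hm : ∀ i, MonotoneOn (f i) (Set.Ioo 0 1)) (w : List (Fin N)) :
    MonotoneOn (applyWord f w) (Set.Ioo 0 1) := by
  induction w with
  | nil => intro x hx y hy h; exact h
  | cons i w ih =>
    intro x hx y hy h
    rw [applyWord_cons, applyWord_cons]
    exact ih (hF i x hx) (hF i y hy) (hm i hx hy h)

lemma reach {N : ℕ} (f : Fin N → ℝ → ℝ)
    (hF : ∀ i, ∀ x ∈ Set.Ioo (0:ℝ) 1, f i x ∈ Set.Ioo (0:ℝ) 1)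
    (hc : ∀ i, ContinuousOn (f i) (Set.Ioo 0 1))
    (hint : ∀ x ∈ Set.Ioo (0:ℝ) 1, ∃ i, f i x < x) (x : ℝ) (hx : x ∈ Set.Ioo (0:ℝ) 1)
    (ε : ℝ) (hε : 0 < ε) :
    ∃ n0 : ℕ, ∀ n ≥ n0, ∃ w : Fin n → Fin N, applyWord f (List.ofFn w) x < ε := by
  have hex : ∃ w : List (Fin N), applyWord f w x < ε := by
    by_contra! hcon
    set S := Set.range (fun w : List (Fin N) => applyWord f w x) with hS
    have hne : S.Nonempty := ⟨_, ⟨[], rfl⟩⟩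
    have hbd : BddBelow S := ⟨ε, by rintro _ ⟨w, rfl⟩; exact hcon w⟩
    have hz1 : ε ≤ sInf S := le_csInf hne (by rintro _ ⟨w, rfl⟩; exact hcon w)
    have hz2 : sInf S ≤ x := csInf_le hbd ⟨[], rfl⟩
    have hzI : sInf S ∈ Set.Ioo (0:ℝ) 1 := ⟨by linarith, by linarith [hx.2]⟩
    obtain ⟨i, hi⟩ := hint _ hzI
    have hcz := (hc i).continuousAt (Ioo_mem_nhds hzI.1 hzI.2)
    have hev := hcz.eventually (gt_mem_nhds hi)
    obtain ⟨δ, hδ, hball⟩ := Metric.eventually_nhds_iff.1 hev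
    obtain ⟨_, ⟨w, rfl⟩, hw⟩ := exists_lt_of_csInf_lt hne (lt_add_of_pos_right (sInf S) hδ)
    have hw1 : sInf S ≤ applyWord f w x := csInf_le hbd ⟨w, rfl⟩
    have h1 : f i (applyWord f w x) < sInf S := by
      apply hball
      rw [Real.dist_eq, abs_of_nonneg (by linarith)]
      linarith [hw]
    have h2 : sInf S ≤ applyWord f (w ++ [i]) x := csInf_le hbd ⟨_, rfl⟩
    rw [applyWord_append] at h2
    exact absurd h2 (not_le.2 h1)
  obtain ⟨w, hw⟩ := hex
  refine ⟨w.length, fun n hn => ?_⟩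
  have : ∃ w' : List (Fin N), w'.length = n ∧ applyWord f w' x < ε := by
    induction n, hn using Nat.le_induction with
    | base => exact ⟨w, rfl, hw⟩
    | succ n _ ih =>
      obtain ⟨w', h1, h2⟩ := ih
      obtain ⟨i, hi⟩ := hint _ (applyWord_mem f hF w' x hx)
      refine ⟨w' ++ [i], by simp [h1], ?_⟩
      rw [applyWord_append]
      exact lt_trans hi h2
  obtain ⟨w', rfl, h2⟩ := this
  exact ⟨w'.get, by rwa [List.ofFn_get]⟩

/-- conjugate system -/
def conjF {N : ℕ} (f : Fin N → ℝ → ℝ) : Fin N → ℝ → ℝ := fun i x => 1 - f i (1 - x)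

lemma applyWord_conj {N : ℕ} (f : Fin N → ℝ → ℝ) (w : List (Fin N)) :
    ∀ x, applyWord (conjF f) w x = 1 - applyWord f w (1 - x) := by
  induction w with
  | nil => intro x; simp [applyWord]
  | cons i w ih => intro x; rw [applyWord_cons, applyWord_cons, ih]; simp [conjF]

lemma sum_word_succ {N : ℕ} (p : Fin N → ℝ) (n : ℕ) (H : List (Fin N) → ℝ) :
    ∑ w : Fin (n+1) → Fin N, (∏ k, p (w k)) * H (List.ofFn w) =
      ∑ i, p i * ∑ w : Fin n → Fin N, (∏ k, p (w k)) * H (i :: List.ofFn w) := by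
  rw [← (Fin.consEquiv (fun _ => Fin N)).sum_comp, Fintype.sum_prod_type]
  refine Finset.sum_congr rfl fun i _ => ?_
  rw [Finset.mul_sum]
  refine Finset.sum_congr rfl fun w _ => ?_
  simp [Fin.consEquiv, Fin.prod_univ_succ, List.ofFn_succ, mul_assoc]

lemma sum_word_one {N : ℕ} (p : Fin N → ℝ) (hs : ∑ i, p i = 1) (n : ℕ) :
    ∑ w : Fin n → Fin N, (∏ k, p (w k)) = 1 := by
  induction n with
  | zero => simp
  | succ n ih =>
    have := sum_word_succ p n (fun _ => 1)
    simp only [mul_one] at this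
    rw [this, ih]
    simpa using hs

lemma word_expand {N : ℕ} (f : Fin N → ℝ → ℝ) (p : Fin N → ℝ) (n : ℕ) (g : ℝ → ℝ) :
    ∀ x, mkOp (fun w : Fin n → Fin N => ∏ k, p (w k)) (fun w => applyWord f (List.ofFn w)) g x
      = (mkOp p f)^[n] g x := by
  induction n with
  | zero => intro x; simp [mkOp, applyWord]
  | succ n ih =>
    intro x
    have := sum_word_succ p n (fun l => g (applyWord f l x))
    rw [Function.iterate_succ_apply']
    unfold mkOp at ih ⊢
    rw [this]
    refine Finset.sum_congr rfl fun i _ => ?_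
    rw [← ih]
    simp only [applyWord_cons]

lemma drift_iter {N : ℕ} (f : Fin N → ℝ → ℝ) (p : Fin N → ℝ)
    (hp : ∀ i, 0 < p i) (hs : ∑ i, p i = 1)
    (hF : ∀ i, ∀ x ∈ Set.Ioo (0:ℝ) 1, f i x ∈ Set.Ioo (0:ℝ) 1)
    (V : ℝ → ℝ) (lam C : ℝ) (hlam : 0 ≤ lam)
    (drift : ∀ x ∈ Set.Ioo (0:ℝ) 1, mkOp p f V x ≤ lam * V x + C * (1 - lam)) (m : ℕ) :
    ∀ x ∈ Set.Ioo (0:ℝ) 1, (mkOp p f)^[m] V x ≤ lam ^ m * V x + C * (1 - lam ^ m) := by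
  induction m with
  | zero => intro x _; simp
  | succ m ih =>
    intro x hx
    rw [Function.iterate_succ_apply']
    calc mkOp p f ((mkOp p f)^[m] V) x
        ≤ ∑ i, p i * (lam ^ m * V (f i x) + C * (1 - lam ^ m)) :=
          Finset.sum_le_sum fun i _ => mul_le_mul_of_nonneg_left (ih _ (hF i x hx)) (hp i).le
      _ = lam ^ m * mkOp p f V x + C * (1 - lam ^ m) := by
          simp only [mul_add, Finset.sum_add_distrib, ← Finset.sum_mul, hs, mkOp, Finset.mul_sum]
          congr 1
          · exact Finset.sum_congr rfl fun i _ => by ring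
          · ring
      _ ≤ lam ^ m * (lam * V x + C * (1 - lam)) + C * (1 - lam ^ m) := by
          have := mul_le_mul_of_nonneg_left (drift x hx) (pow_nonneg hlam m)
          linarith
      _ = _ := by ring

lemma sum_range_block (a : ℕ → ℝ) (m K : ℕ) :
    ∑ n ∈ Finset.range (m * K), a n = ∑ r ∈ Finset.range m, ∑ k ∈ Finset.range K, a (m * k + r) := by
  induction K with
  | zero => simp
  | succ K ih =>
    rw [Nat.mul_succ, Finset.sum_range_add, ih, ← Finset.sum_add_distrib]
    exact Finset.sum_congr rfl fun r _ => by rw [Finset.sum_range_succ]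

lemma adm_maps {N : ℕ} {f : Fin N → ℝ → ℝ} {p d e : Fin N → ℝ} (h : AdmissibleIFS N f p d e) :
    ∀ i, ∀ x ∈ Set.Ioo (0:ℝ) 1, f i x ∈ Set.Ioo (0:ℝ) 1 := by
  intro i x hx
  constructor
  · have := h.mono i (by simp : (0:ℝ) ∈ Set.Icc 0 1) ⟨hx.1.le, hx.2.le⟩ hx.1
    rwa [h.fix0] at this
  · have := h.mono i ⟨hx.1.le, hx.2.le⟩ (by simp : (1:ℝ) ∈ Set.Icc 0 1) hx.2
    rwa [h.fix1] at this

lemma sum_bound {N : ℕ} {f : Fin N → ℝ → ℝ} {p d e : Fin N → ℝ} (h : AdmissibleIFS N f p d e) :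
    ∃ H : ℝ → ℝ → ℝ, ∀ u ∈ Set.Ioo (0:ℝ) 1, ∀ v ∈ Set.Ioo (0:ℝ) 1, u < v → ∀ n,
      ∑ k ∈ Finset.range n, ((mkOp p f)^[k] id v - (mkOp p f)^[k] id u) ≤ H u v := by
  classical
  have hF := adm_maps h
  have hm : ∀ i, MonotoneOn (f i) (Set.Ioo 0 1) := fun i =>
    ((h.mono i).monotoneOn).mono Set.Ioo_subset_Icc_self
  have hp := h.ppos
  have hs := h.psum
  have hrefl : ∀ x ∈ Set.Ioo (0:ℝ) 1, 1 - x ∈ Set.Ioo (0:ℝ) 1 := fun x hx =>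
    ⟨by linarith [hx.2], by linarith [hx.1]⟩
  have hreflc : ∀ x ∈ Set.Icc (0:ℝ) 1, 1 - x ∈ Set.Icc (0:ℝ) 1 := fun x hx =>
    ⟨by linarith [hx.2], by linarith [hx.1]⟩
  have hF' : ∀ i, ∀ x ∈ Set.Ioo (0:ℝ) 1, conjF f i x ∈ Set.Ioo (0:ℝ) 1 := fun i x hx =>
    hrefl _ (hF i _ (hrefl x hx))
  have hm' : ∀ i, MonotoneOn (conjF f i) (Set.Ioo 0 1) := by
    intro i x hx y hy hxy
    have := hm i (hrefl y hy) (hrefl x hx) (by linarith)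
    simp only [conjF]; linarith
  have hder' : ∀ i, HasDerivWithinAt (conjF f i) (e i) (Set.Icc 0 1) 0 := by
    intro i
    have h1 : HasDerivWithinAt (fun x : ℝ => 1 - x) (-1) (Set.Icc 0 1) 0 :=
      ((hasDerivAt_id (0:ℝ)).const_sub 1).hasDerivWithinAt
    have h2 : HasDerivWithinAt (f i) (e i) (Set.Icc 0 1) ((fun x : ℝ => 1 - x) 0) := by
      simpa using h.deriv1 i
    have h3 := (h2.comp (0:ℝ) h1 hreflc).const_sub 1
    have h4 : -(e i * -1) = e i := by ring
    rw [h4] at h3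
    exact h3
  obtain ⟨V1, l1, C1, hl10, hl11, hC1, hV1, hd1, hR1⟩ :=
    drift_end f p d hp hs h.dpos h.fix0 hF hm h.deriv0 h.lyap0
  obtain ⟨V2, l2, C2, hl20, hl21, hC2, hV2, hd2, hR2⟩ :=
    drift_end (conjF f) p e hp hs h.epos (fun i => by simp [conjF, h.fix1]) hF' hm' hder' h.lyap1
  set V : ℝ → ℝ := fun x => V1 x + V2 (1 - x) with hVdef
  have hV : ∀ x ∈ Set.Ioo (0:ℝ) 1, 0 ≤ V x := fun x hx =>
    add_nonneg (hV1 x hx) (hV2 _ (hrefl x hx))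
  set lam := max l1 l2 with hlamdef
  have hlam0 : 0 ≤ lam := hl10.trans (le_max_left _ _)
  have hlam1 : lam < 1 := max_lt hl11 hl21
  set C := (C1 + C2) / (1 - lam) with hCdef
  have hl' : 0 < 1 - lam := by linarith
  have hC : 0 ≤ C := by positivity
  have drift : ∀ x ∈ Set.Ioo (0:ℝ) 1, mkOp p f V x ≤ lam * V x + C * (1 - lam) := by
    intro x hx
    have e1 : mkOp p f V x = mkOp p f V1 x + mkOp p (conjF f) V2 (1 - x) := by
      simp [mkOp, hVdef, conjF, mul_add, Finset.sum_add_distrib]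
    have a1 := hd1 x hx
    have a2 := hd2 _ (hrefl x hx)
    have b1 := mul_le_mul_of_nonneg_right (le_max_left l1 l2) (hV1 x hx)
    have b2 := mul_le_mul_of_nonneg_right (le_max_right l1 l2) (hV2 _ (hrefl x hx))
    have e2 : C * (1 - lam) = C1 + C2 := by rw [hCdef]; field_simp
    rw [e1, e2]
    simp only [hVdef]
    linarith
  set R := (2 * C + 1) / (1 - lam) with hRdef
  obtain ⟨ε1, hε1, hE1⟩ := hR1 R
  obtain ⟨ε2, hε2, hE2⟩ := hR2 R
  set ε := min (min ε1 ε2) (1/2) with hεdef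
  have hε0 : 0 < ε := by positivity
  have hεI : ε ∈ Set.Ioo (0:ℝ) 1 := ⟨hε0, lt_of_le_of_lt (min_le_right _ _) (by norm_num)⟩
  have hεa : ε ≤ ε1 := (min_le_left _ _).trans (min_le_left _ _)
  have hεb : ε ≤ ε2 := (min_le_left _ _).trans (min_le_right _ _)
  have hcont : ∀ i, ContinuousOn (f i) (Set.Ioo 0 1) := fun i =>
    (h.cont i).mono Set.Ioo_subset_Icc_self
  obtain ⟨n1, hn1⟩ := reach f hF hcont (fun x hx => (h.interior x hx).1) (1 - ε) (hrefl ε hεI)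
    (1/2) (by norm_num)
  obtain ⟨n2, hn2⟩ := reach (conjF f) hF'
    (fun i => by
      have : ContinuousOn (fun x : ℝ => 1 - x) (Set.Ioo 0 1) := by fun_prop
      exact continuousOn_const.sub ((hcont i).comp this hrefl))
    (fun x hx => by
      obtain ⟨i, hi⟩ := (h.interior _ (hrefl x hx)).2
      exact ⟨i, by simp only [conjF]; linarith⟩) (1 - ε) (hrefl ε hεI)
    (1/2) (by norm_num)
  set m := n1 + n2 + 1 with hmdef
  obtain ⟨a, ha⟩ := hn1 m (by omega)
  obtain ⟨b, hb⟩ := hn2 m (by omega)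
  rw [applyWord_conj, sub_sub_cancel] at hb
  set q : (Fin m → Fin N) → ℝ := fun w => ∏ k, p (w k) with hqdef
  set F : (Fin m → Fin N) → ℝ → ℝ := fun w => applyWord f (List.ofFn w) with hFdef
  have hqpos : ∀ w, 0 < q w := fun w => Finset.prod_pos fun k _ => hp _
  have hop : mkOp q F = (mkOp p f)^[m] := by
    funext g x
    exact word_expand f p m g x
  have hFF : ∀ w, ∀ x ∈ Set.Ioo (0:ℝ) 1, F w x ∈ Set.Ioo (0:ℝ) 1 := fun w =>
    applyWord_mem f hF _
  have hFm : ∀ w, MonotoneOn (F w) (Set.Ioo 0 1) := fun w => applyWord_mono f hF hm _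
  set B := (2 * C + 1) / (q b * q a) with hBdef
  have hqq : 0 < q b * q a := mul_pos (hqpos b) (hqpos a)
  have hB : 0 ≤ B := by positivity
  have hid : GoodFn id := ⟨fun x _ y _ hxy => hxy, fun x hx => ⟨hx.1.le, hx.2.le⟩⟩
  refine ⟨fun u v => m * (V u + V v + B), fun u hu v hv huv n => ?_⟩
  have hgood := fun k => goodFn_iter p f (fun i => (hp i).le) hs hF hm id hid k
  calc ∑ k ∈ Finset.range n, ((mkOp p f)^[k] id v - (mkOp p f)^[k] id u)
      ≤ ∑ k ∈ Finset.range (m * n), ((mkOp p f)^[k] id v - (mkOp p f)^[k] id u) := by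
        refine Finset.sum_le_sum_of_subset_of_nonneg
          (Finset.range_mono (Nat.le_mul_of_pos_left n (by omega))) fun k _ _ => ?_
        exact sub_nonneg.2 ((hgood k).1 hu hv huv.le)
    _ = ∑ r ∈ Finset.range m, ∑ k ∈ Finset.range n,
        ((mkOp q F)^[k] ((mkOp p f)^[r] id) v - (mkOp q F)^[k] ((mkOp p f)^[r] id) u) := by
        rw [sum_range_block (fun k => (mkOp p f)^[k] id v - (mkOp p f)^[k] id u)]
        refine Finset.sum_congr rfl fun r _ => Finset.sum_congr rfl fun k _ => ?_
        rw [hop, ← Function.iterate_mul, ← Function.iterate_add_apply]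
    _ ≤ ∑ r ∈ Finset.range m, (V u + V v + B) := by
        refine Finset.sum_le_sum fun r _ => ?_
        refine core q F (fun w => (hqpos w).le) (sum_word_one p hs m) hFF hFm V hV lam C R B
          hlam1 hC hB ?_ a b ?_ ?_ ?_ _ (hgood r) n u hu v hv huv
        · intro x hx
          rw [hop]
          have h1 := drift_iter f p hp hs hF V lam C hlam0 drift m x hx
          have h2 : lam ^ m ≤ lam := pow_le_of_le_one hlam0 hlam1.le (by omega)
          have h3 := mul_le_mul_of_nonneg_right h2 (hV x hx)
          have h4 : C * (1 - lam ^ m) ≤ C * 1 :=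
            mul_le_mul_of_nonneg_left (by linarith [pow_nonneg hlam0 m]) hC
          linarith
        · intro u hu v hv hVu hVv
          have h1 : ε ≤ u := hεa.trans (hE1 u hu (by
            have := hV2 _ (hrefl u hu)
            simp only [hVdef] at hVu; linarith))
          have h2 : ε ≤ 1 - v := hεb.trans (hE2 _ (hrefl v hv) (by
            have := hV1 _ hv
            simp only [hVdef] at hVv; linarith))
          have h3 := hFm a hv (hrefl ε hεI) (by linarith)
          have h4 := hFm b hεI hu h1
          simp only [hFdef] at h3 h4 ⊢
          linarith
        · rw [hRdef]; field_simp; exact le_rfl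
        · rw [hBdef, div_mul_cancel₀ _ hqq.ne']
    _ = _ := by simp; ring

lemma path_sum {N : ℕ} (f : Fin N → ℝ → ℝ) (p : Fin N → ℝ) (hs : ∑ i, p i = 1) (n : ℕ) : ∀ x,
    ∑ w : Fin n → Fin N, (∏ k, p (w k)) *
      (∑ j ∈ Finset.Icc 1 n, applyWord f ((List.ofFn w).take j) x)
      = ∑ j ∈ Finset.range n, (mkOp p f)^[j+1] id x := by
  have hshift : ∀ (n : ℕ) (G : ℕ → ℝ), ∑ j ∈ Finset.Icc 1 n, G j = ∑ j ∈ Finset.range n, G (j+1) := by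
    intro n G
    rw [Finset.range_eq_Ico, Finset.sum_Ico_add' G 0 n 1]
    rfl
  simp_rw [hshift]
  induction n with
  | zero => intro x; simp
  | succ n ih =>
    intro x
    rw [sum_word_succ p n (fun l => ∑ j ∈ Finset.range (n+1), applyWord f (l.take (j+1)) x),
      Finset.sum_range_succ']
    simp_rw [List.take_succ_cons, applyWord_cons, Finset.sum_range_succ', mul_add,
      Finset.sum_add_distrib, ih]
    simp_rw [Function.iterate_succ_apply' (mkOp p f) (_ + 1)]
    rw [← mkOp_sum]
    simp [applyWord, mkOp, ← Finset.sum_mul, sum_word_one p hs n, mul_add, Finset.sum_add_distrib]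

lemma expdiff (a b : ℝ) : ‖Complex.exp (Complex.I * a) - Complex.exp (Complex.I * b)‖ ≤ |a - b| := by
  have h1 : Complex.exp (Complex.I * a) - Complex.exp (Complex.I * b)
      = Complex.exp (Complex.I * b) * (Complex.exp (Complex.I * ((a - b : ℝ) : ℂ)) - 1) := by
    rw [mul_sub, ← Complex.exp_add, mul_one]; congr 2; push_cast; ring
  rw [h1, norm_mul, mul_comm Complex.I (b:ℂ), Complex.norm_exp_ofReal_mul_I, one_mul]
  exact Real.norm_exp_I_mul_ofReal_sub_one_le

lemma charFn_diff {N : ℕ} {f : Fin N → ℝ → ℝ} {p d e : Fin N → ℝ} (h : AdmissibleIFS N f p d e)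
    (φ : ℝ → ℝ) (L : ℝ) (hL : 0 ≤ L)
    (hφ : ∀ a ∈ Set.Icc (0:ℝ) 1, ∀ b ∈ Set.Icc (0:ℝ) 1, |φ a - φ b| ≤ L * |a - b|)
    (n : ℕ) (t u v : ℝ) (hu : u ∈ Set.Ioo (0:ℝ) 1) (hv : v ∈ Set.Ioo (0:ℝ) 1) (huv : u ≤ v) :
    ‖charFn f p φ n t v - charFn f p φ n t u‖ ≤ (|t| * L / Real.sqrt n) *
      ∑ j ∈ Finset.range n, ((mkOp p f)^[j+1] id v - (mkOp p f)^[j+1] id u) := by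
  have hF := adm_maps h
  have hm : ∀ i, MonotoneOn (f i) (Set.Ioo 0 1) := fun i =>
    ((h.mono i).monotoneOn).mono Set.Ioo_subset_Icc_self
  rw [Finset.sum_sub_distrib, ← path_sum f p h.psum, ← path_sum f p h.psum,
    ← Finset.sum_sub_distrib]
  unfold charFn
  rw [← Finset.sum_sub_distrib, Finset.mul_sum]
  refine (norm_sum_le _ _).trans (Finset.sum_le_sum fun w _ => ?_)
  have hpw : 0 ≤ ∏ k, p (w k) := Finset.prod_nonneg fun k _ => (h.ppos _).le
  rw [← mul_sub, ← mul_sub, norm_mul, Complex.norm_real, Real.norm_of_nonneg hpw, mul_left_comm]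
  refine mul_le_mul_of_nonneg_left ?_ hpw
  have he := expdiff (t * ((∑ j ∈ Finset.Icc 1 n, φ (applyWord f ((List.ofFn w).take j) v)) / Real.sqrt n))
    (t * ((∑ j ∈ Finset.Icc 1 n, φ (applyWord f ((List.ofFn w).take j) u)) / Real.sqrt n))
  rw [Complex.ofReal_mul, Complex.ofReal_mul, ← mul_assoc, ← mul_assoc] at he
  refine he.trans ?_
  rw [← mul_sub, ← sub_div, abs_mul, abs_div, abs_of_nonneg (Real.sqrt_nonneg _)]
  rw [← Finset.sum_sub_distrib, ← Finset.sum_sub_distrib]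
  have hle : |∑ j ∈ Finset.Icc 1 n, (φ (applyWord f ((List.ofFn w).take j) v)
      - φ (applyWord f ((List.ofFn w).take j) u))| ≤
      L * ∑ j ∈ Finset.Icc 1 n, (applyWord f ((List.ofFn w).take j) v
        - applyWord f ((List.ofFn w).take j) u) := by
    refine (Finset.abs_sum_le_sum_abs _ _).trans ?_
    rw [Finset.mul_sum]
    refine Finset.sum_le_sum fun j _ => ?_
    have h1 := hφ _ (Set.Ioo_subset_Icc_self (applyWord_mem f hF ((List.ofFn w).take j) v hv))
      _ (Set.Ioo_subset_Icc_self (applyWord_mem f hF ((List.ofFn w).take j) u hu))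
    rwa [abs_of_nonneg (a := applyWord f ((List.ofFn w).take j) v
        - applyWord f ((List.ofFn w).take j) u)
      (sub_nonneg.2 (applyWord_mono f hF hm _ hu hv huv))] at h1
  calc _ ≤ |t| * ((L * ∑ j ∈ Finset.Icc 1 n, (applyWord f ((List.ofFn w).take j) v
        - applyWord f ((List.ofFn w).take j) u)) / Real.sqrt n) := by gcongr
    _ = _ := by ring

lemma charFn_tendsto_lt {N : ℕ} {f : Fin N → ℝ → ℝ} {p d e : Fin N → ℝ}
    (h : AdmissibleIFS N f p d e)
    (φ : ℝ → ℝ) (L : ℝ) (hL : 0 ≤ L)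
    (hφ : ∀ a ∈ Set.Icc (0:ℝ) 1, ∀ b ∈ Set.Icc (0:ℝ) 1, |φ a - φ b| ≤ L * |a - b|)
    (t u v : ℝ) (hu : u ∈ Set.Ioo (0:ℝ) 1) (hv : v ∈ Set.Ioo (0:ℝ) 1) (huv : u < v) :
    Tendsto (fun n : ℕ => charFn f p φ n t v - charFn f p φ n t u) atTop (nhds 0) := by
  obtain ⟨H, hH⟩ := sum_bound h
  have hsq : Tendsto (fun n : ℕ => (|t| * L / Real.sqrt n) * H u v) atTop (nhds 0) := by
    have h1 : Tendsto (fun n : ℕ => Real.sqrt n) atTop atTop :=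
      Real.tendsto_sqrt_atTop.comp tendsto_natCast_atTop_atTop
    have h2 := (h1.const_div_atTop (|t| * L)).mul_const (H u v)
    simpa using h2
  refine squeeze_zero_norm (fun n => ?_) hsq
  refine (charFn_diff h φ L hL hφ n t u v hu hv huv.le).trans ?_
  refine mul_le_mul_of_nonneg_left ?_ (by positivity)
  have h1 := hH u hu v hv huv (n+1)
  rw [Finset.sum_range_succ'] at h1
  simp only [Function.iterate_zero, id] at h1
  linarith

lemma charFn_tendsto {N : ℕ} {f : Fin N → ℝ → ℝ} {p d e : Fin N → ℝ}
    (h : AdmissibleIFS N f p d e)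
    (φ : ℝ → ℝ) (L : ℝ) (hL : 0 ≤ L)
    (hφ : ∀ a ∈ Set.Icc (0:ℝ) 1, ∀ b ∈ Set.Icc (0:ℝ) 1, |φ a - φ b| ≤ L * |a - b|)
    (t u v : ℝ) (hu : u ∈ Set.Ioo (0:ℝ) 1) (hv : v ∈ Set.Ioo (0:ℝ) 1) :
    Tendsto (fun n : ℕ => charFn f p φ n t v - charFn f p φ n t u) atTop (nhds 0) := by
  rcases lt_trichotomy u v with huv | rfl | huv
  · exact charFn_tendsto_lt h φ L hL hφ t u v hu hv huv
  · simp
  · have := (charFn_tendsto_lt h φ L hL hφ t v u hv hu huv).neg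
    simpa using this

lemma charFn_norm {N : ℕ} (f : Fin N → ℝ → ℝ) (p : Fin N → ℝ) (hp : ∀ i, 0 < p i)
    (hs : ∑ i, p i = 1) (φ : ℝ → ℝ) (n : ℕ) (t x : ℝ) : ‖charFn f p φ n t x‖ ≤ 1 := by
  unfold charFn
  rw [← sum_word_one p hs n]
  refine (norm_sum_le _ _).trans (Finset.sum_le_sum fun w _ => ?_)
  have hpw : 0 ≤ ∏ k, p (w k) := Finset.prod_nonneg fun k _ => (hp _).le
  rw [norm_mul, Complex.norm_real, Real.norm_of_nonneg hpw, mul_assoc, ← Complex.ofReal_mul,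
    mul_comm Complex.I, Complex.norm_exp_ofReal_mul_I, mul_one]

lemma charFn_meas {N : ℕ} (f : Fin N → ℝ → ℝ) (p : Fin N → ℝ) (hf : ∀ i, Measurable (f i))
    (φ : ℝ → ℝ) (hφ : Measurable φ) (n : ℕ) (t : ℝ) : Measurable (fun x => charFn f p φ n t x) := by
  have hw : ∀ w : List (Fin N), Measurable (applyWord f w) := by
    intro w
    induction w with
    | nil => exact measurable_id
    | cons i w ih =>
      have : applyWord f (i :: w) = applyWord f w ∘ f i := by funext x; exact applyWord_cons f i w x
      rw [this]; exact ih.comp (hf i)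
  unfold charFn
  refine Finset.measurable_sum _ fun w _ => ?_
  refine measurable_const.mul (Complex.measurable_exp.comp (measurable_const.mul
    (Complex.measurable_ofReal.comp (Measurable.div_const ?_ _))))
  exact Finset.measurable_sum _ fun j _ => hφ.comp (hw _)

/-- (Quenched CLT via coupling of characteristic functions.)
Under the hypotheses of the annealed CLT, for every `x ∈ (0,1)` and `t ∈ ℝ`,
`|Φₙˣ(t) − Φₙ(t)| → 0`, where `Φₙ` is the characteristic function of the stationary
chain; consequently if `Φₙ(t) → exp(−t²σ²/2)` (the stationary CLT), then also
`Φₙˣ(t) → exp(−t²σ²/2)` for every `x ∈ (0,1)`, i.e. the quenched CLT holds. -/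
theorem stmt18 (N : ℕ) (f : Fin N → ℝ → ℝ) (p d e : Fin N → ℝ)
    (hadm : AdmissibleIFS N f p d e)
    (μstar : Measure ℝ) (hprob : IsProbabilityMeasure μstar)
    (hμ01 : μstar (Ioo (0:ℝ) 1) = 1)
    (hinv : (∑ i, ENNReal.ofReal (p i) • Measure.map (f i) μstar) = μstar)
    (φ : ℝ → ℝ) (L : ℝ) (hL : 0 ≤ L) (hφmeas : Measurable φ)
    (hφ : ∀ a ∈ Icc (0:ℝ) 1, ∀ b ∈ Icc (0:ℝ) 1, |φ a - φ b| ≤ L * |a - b|)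
    (hφ0 : ∫ x, φ x ∂μstar = 0) :
    (∀ x ∈ Ioo (0:ℝ) 1, ∀ t : ℝ,
      Tendsto (fun n : ℕ =>
          charFn f p φ n t x - ∫ y, charFn f p φ n t y ∂μstar)
        atTop (nhds 0)) ∧
    (∀ σ2 : NNReal,
      (∀ t : ℝ, Tendsto (fun n : ℕ => ∫ y, charFn f p φ n t y ∂μstar)
        atTop (nhds (Complex.exp (-(t : ℂ) ^ 2 * (σ2 : ℂ) / 2)))) →
      ∀ x ∈ Ioo (0:ℝ) 1, ∀ t : ℝ,
        Tendsto (fun n : ℕ => charFn f p φ n t x)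
          atTop (nhds (Complex.exp (-(t : ℂ) ^ 2 * (σ2 : ℂ) / 2)))) := by
  
  have main : ∀ x ∈ Set.Ioo (0:ℝ) 1, ∀ t : ℝ,
      Tendsto (fun n : ℕ =>
          charFn f p φ n t x - ∫ y, charFn f p φ n t y ∂μstar)
        atTop (nhds 0) := by
    intro x hx t
    have hmeas := fun n => charFn_meas f p hadm.meas φ hφmeas n t
    have hbd := fun n y => charFn_norm f p hadm.ppos hadm.psum φ n t y
    have hint : ∀ n, Integrable (fun y => charFn f p φ n t y) μstar := fun n =>
      Integrable.of_bound (hmeas n).aestronglyMeasurable 1 (Eventually.of_forall fun y => hbd n y)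
    have heq : ∀ n, charFn f p φ n t x - ∫ y, charFn f p φ n t y ∂μstar
        = ∫ y, (charFn f p φ n t x - charFn f p φ n t y) ∂μstar := by
      intro n
      rw [integral_sub (integrable_const _) (hint n)]
      simp
    simp_rw [heq]
    have hae : ∀ᵐ y ∂μstar, y ∈ Set.Ioo (0:ℝ) 1 := by
      rw [← prob_compl_eq_zero_iff measurableSet_Ioo] at hμ01
      exact hμ01
    have := tendsto_integral_of_dominated_convergence (μ := μstar)
      (F := fun (n : ℕ) y => charFn f p φ n t x - charFn f p φ n t y) (f := fun _ => 0)
      (fun _ => 2)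
      (fun n => ((measurable_const.sub (hmeas n)).aestronglyMeasurable))
      (integrable_const _)
      (fun n => Eventually.of_forall fun y => by
        have := norm_sub_le (charFn f p φ n t x) (charFn f p φ n t y)
        linarith [hbd n x, hbd n y])
      (by
        filter_upwards [hae] with y hy
        exact charFn_tendsto hadm φ L hL hφ t y x hy hx)
    simpa using this
  refine ⟨main, fun σ2 hσ x hx t => ?_⟩
  have := (main x hx t).add (hσ t)
  simpa using this
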